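/- If in the Hamiltonian GBDT setup one has H₁(x) ≥ 0 (positive semidefinite) for a.e. x and S(0) > 0 (positive definite), then S(x) > 0, and in particular S(x) is invertible, for all x ∈ [0,ℓ). -/

import Mathlib

open Matrix Set
open scoped ComplexOrder

attribute [local instance] Matrix.normedAddCommGroup Matrix.normedSpace

/-- Entries of a differentiable matrix function are differentiable. -/
theorem HasDerivAt.matrix_entry {m n : ℕ} {S : ℝ → Matrix (Fin m) (Fin n) ℂ}
    {S' : Matrix (Fin m) (Fin n) ℂ} {x : ℝ} (h : HasDerivAt S S' x) (i : Fin m) (j : Fin n) :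
    HasDerivAt (fun t => S t i j) (S' i j) x :=
  hasDerivAt_pi.1 (hasDerivAt_pi.1 h i) j

/-- Along a matrix function with positive semidefinite derivative, increments are positive
semidefinite. -/
theorem Matrix.posSemidef_sub_of_hasDerivAt {n : ℕ} {S S' : ℝ → Matrix (Fin n) (Fin n) ℂ}
    {a b : ℝ} (hab : a ≤ b) (hS : ∀ t ∈ Icc a b, HasDerivAt S (S' t) t)
    (hS' : ∀ t ∈ Icc a b, (S' t).PosSemidef) : (S b - S a).PosSemidef := by
  have hherm : (S b - S a).IsHermitian := by
    ext i j
    have hd : ∀ t ∈ Icc a b, HasDerivAt (fun t => star (S t j i) - S t i j) 0 t := by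
      intro t ht
      have h := ((hS t ht).matrix_entry j i).star.sub ((hS t ht).matrix_entry i j)
      rwa [(hS' t ht).isHermitian.apply i j, sub_self] at h
    have hc := constant_of_has_deriv_right_zero
      (fun t ht => (hd t ht).continuousAt.continuousWithinAt)
      (fun t ht => (hd t (Ico_subset_Icc_self ht)).hasDerivWithinAt) b ⟨hab, le_rfl⟩
    simp only [conjTranspose_apply, sub_apply, star_sub]
    linear_combination hc
  refine PosSemidef.of_dotProduct_mulVec_nonneg hherm fun v => ?_
  rw [Complex.nonneg_iff]
  refine ⟨?_, (hherm.im_star_dotProduct_mulVec_self v).symm⟩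
  have hd : ∀ t ∈ Icc a b,
      HasDerivAt (fun t => (star v ⬝ᵥ S t *ᵥ v).re) (star v ⬝ᵥ S' t *ᵥ v).re t := by
    intro t ht
    have h : HasDerivAt (fun t => star v ⬝ᵥ S t *ᵥ v) (star v ⬝ᵥ S' t *ᵥ v) t := by
      simp only [dotProduct, mulVec]
      exact HasDerivAt.fun_sum fun i _ => HasDerivAt.const_mul _ <|
        HasDerivAt.fun_sum fun j _ => ((hS t ht).matrix_entry i j).mul_const _
    exact Complex.reCLM.hasFDerivAt.comp_hasDerivAt t h
  have hmono : MonotoneOn (fun t => (star v ⬝ᵥ S t *ᵥ v).re) (Icc a b) :=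
    monotoneOn_of_hasDerivWithinAt_nonneg (convex_Icc a b)
      (fun t ht => (hd t ht).continuousAt.continuousWithinAt)
      (fun t ht => (hd t (interior_subset ht)).hasDerivWithinAt)
      (fun t ht => ((hS' t (interior_subset ht)).dotProduct_mulVec_nonneg v).1)
  have := hmono ⟨le_rfl, hab⟩ ⟨hab, le_rfl⟩ hab
  simpa [sub_mulVec, dotProduct_sub] using this

/-- **Positivity of `S(x)` in the Hamiltonian GBDT setup.**  If `H₁(x) ≥ 0` and
`S(0) > 0`, then `S(x) > 0` (in particular `S(x)` is invertible) for all `x ∈ [0,ℓ)`. -/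
theorem gbdt_S_posDef
    (n m : ℕ) (ℓ : ℝ)
    (J : Matrix (Fin m) (Fin m) ℂ) (hJ : Jᴴ = -J)
    (H₁ H₀ : ℝ → Matrix (Fin m) (Fin m) ℂ)
    (hH₁ : ∀ x ∈ Ico (0 : ℝ) ℓ, (H₁ x).PosSemidef)
    (hH₀ : ∀ x ∈ Ico (0 : ℝ) ℓ, (H₀ x).IsHermitian)
    (A : Matrix (Fin n) (Fin n) ℂ)
    (Pi : ℝ → Matrix (Fin n) (Fin m) ℂ)
    (S : ℝ → Matrix (Fin n) (Fin n) ℂ)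
    (hS0 : (S 0).PosDef)
    (hInit : A * S 0 - S 0 * Aᴴ = Pi 0 * J * (Pi 0)ᴴ)
    (hPi : ∀ x ∈ Ico (0 : ℝ) ℓ,
      HasDerivAt Pi (-(A * Pi x * J * H₁ x) - Pi x * J * H₀ x) x)
    (hS : ∀ x ∈ Ico (0 : ℝ) ℓ,
      HasDerivAt S (Pi x * J * H₁ x * Jᴴ * (Pi x)ᴴ) x) :
    ∀ x ∈ Ico (0 : ℝ) ℓ, (S x).PosDef ∧ IsUnit (S x) := by
  intro x hx
  have hmem : ∀ t ∈ Icc 0 x, t ∈ Ico (0 : ℝ) ℓ := fun t ht => ⟨ht.1, ht.2.trans_lt hx.2⟩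
  have hincr : (S x - S 0).PosSemidef :=
    posSemidef_sub_of_hasDerivAt hx.1 (fun t ht => hS t (hmem t ht)) fun t ht => by
      simpa [conjTranspose_mul, Matrix.mul_assoc] using
        (hH₁ t (hmem t ht)).mul_mul_conjTranspose_same (Pi t * J)
  have hpos : (S x).PosDef := by
    simpa using hS0.add_posSemidef hincr
  exact ⟨hpos, hpos.isUnit⟩
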